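/- For every k ≥ 38 with k ≡ 14 (mod 24), there exists an almost resolvable k-cycle system of order 2k+1. -/

import Mathlib

/-- The set of edges of the closed walk `c 0, c 1, …, c (k-1), c 0`.
When `c` is injective, this is a cycle of length `k`. -/
def cycleEdgeSet {V : Type*} {k : ℕ} (c : ZMod k → V) : Set (Sym2 V) :=
  {e | ∃ i : ZMod k, e = s(c i, c (i + 1))}

/-- `HasARCS k v` asserts the existence of an almost resolvable `k`-cycle system of
order `v`: a collection of `k`-cycles whose edge sets partition the edge set of the
complete graph on `v` vertices, partitioned into `(v-1)/2` almost parallel classes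
(each consisting of `(v-1)/k` pairwise vertex-disjoint `k`-cycles) together with one
half-parallel class (consisting of `(v-1)/(2k)` pairwise vertex-disjoint `k`-cycles). -/
def HasARCS (k v : ℕ) : Prop :=
  ∃ (apc : Fin ((v - 1) / 2) → Fin ((v - 1) / k) → ZMod k → Fin v)
    (hpc : Fin ((v - 1) / (2 * k)) → ZMod k → Fin v),
    (∀ i j, Function.Injective (apc i j)) ∧
    (∀ j, Function.Injective (hpc j)) ∧
    (∀ i, ∀ j₁ j₂, j₁ ≠ j₂ →
      Disjoint (Set.range (apc i j₁)) (Set.range (apc i j₂))) ∧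
    (∀ j₁ j₂, j₁ ≠ j₂ → Disjoint (Set.range (hpc j₁)) (Set.range (hpc j₂))) ∧
    (∀ e : Sym2 (Fin v), ¬ e.IsDiag →
      ∃! p : (Fin ((v - 1) / 2) × Fin ((v - 1) / k)) ⊕ Fin ((v - 1) / (2 * k)),
        e ∈ Sum.elim (fun q => cycleEdgeSet (apc q.1 q.2))
              (fun j => cycleEdgeSet (hpc j)) p)

/-! ### The base cycles -/

/-- A zigzag path alternating between the orbits `o` and `p`. -/
def zig (o p : Fin 4) (a d b : ℤ) (i : ℕ) : Option (Fin 4 × ℤ) :=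
  if i % 2 = 0 then some (o, a + d * ((i / 2 : ℕ) : ℤ)) else some (p, b - d * ((i / 2 : ℕ) : ℤ))

def cyc00 (t i : ℕ) : Option (Fin 4 × ℤ) :=
  if i < 6 * t + 3 then zig 0 0 (6 * (t : ℤ) + 2) (-1) (0) (i - (0)) else
  if i < 12 * t + 7 then zig 2 2 (9 * (t : ℤ) + 3) (-1) (9 * (t : ℤ) + 4) (i - (6 * t + 3)) else
  if i < 12 * t + 8 then zig 3 3 (12 * (t : ℤ) + 5) (1) (0) (i - (12 * t + 7)) else
  if i < 24 * t + 13 then zig 1 0 (6 * (t : ℤ) + 3) (-1) (6 * (t : ℤ) + 4) (i - (12 * t + 8)) else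
  zig 0 0 (12 * (t : ℤ) + 6) (1) (0) (i - (24 * t + 13))

def cyc01 (t i : ℕ) : Option (Fin 4 × ℤ) :=
  if i < 6 * t + 2 then zig 1 1 (6 * (t : ℤ) + 4) (1) (0) (i - (0)) else
  if i < 6 * t + 3 then zig 1 1 (9 * (t : ℤ) + 5) (1) (0) (i - (6 * t + 2)) else
  if i < 6 * t + 4 then zig 1 1 (9 * (t : ℤ) + 6) (1) (0) (i - (6 * t + 3)) else
  if i < 6 * t + 5 then none else
  if i < 12 * t + 8 then zig 3 3 (3 * (t : ℤ)) (1) (3 * (t : ℤ) - 1) (i - (6 * t + 5)) else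
  if i < 24 * t + 13 then zig 3 2 (12 * (t : ℤ) + 4) (-1) (12 * (t : ℤ) + 6) (i - (12 * t + 8)) else
  zig 2 2 (6 * (t : ℤ) + 1) (1) (0) (i - (24 * t + 13))

def cyc10 (t i : ℕ) : Option (Fin 4 × ℤ) :=
  if i < 12 * t + 5 then zig 2 0 (12 * (t : ℤ) + 6) (-1) (6 * (t : ℤ) + 6) (i - (0)) else
  if i < 12 * t + 6 then zig 3 3 (6 * (t : ℤ) + 3) (1) (0) (i - (12 * t + 5)) else
  if i < 12 * t + 7 then zig 0 0 (6 * (t : ℤ) + 4) (1) (0) (i - (12 * t + 6)) else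
  if i < 24 * t + 13 then zig 3 0 (6 * (t : ℤ) + 4) (1) (6 * (t : ℤ) + 3) (i - (12 * t + 7)) else
  none

def cyc11 (t i : ℕ) : Option (Fin 4 × ℤ) :=
  if i < 12 * t + 7 then zig 1 3 (1) (1) (6 * (t : ℤ) + 2) (i - (0)) else
  if i < 12 * t + 8 then zig 2 2 (6 * (t : ℤ) + 3) (1) (0) (i - (12 * t + 7)) else
  if i < 12 * t + 9 then zig 1 1 (6 * (t : ℤ) + 5) (1) (0) (i - (12 * t + 8)) else
  if i < 12 * t + 10 then zig 0 0 (6 * (t : ℤ) + 5) (1) (0) (i - (12 * t + 9)) else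
  zig 1 2 (6 * (t : ℤ) + 6) (1) (6 * (t : ℤ) + 2) (i - (12 * t + 10))

/-- The four base cycles: `base t c q` is the `q`-th cycle of the `c`-th base class. -/
def base (t : ℕ) (c q : Fin 2) : ℕ → Option (Fin 4 × ℤ) :=
  if c = 0 then (if q = 0 then cyc00 t else cyc01 t) else (if q = 0 then cyc10 t else cyc11 t)

/-- On the index range `[s, e)` the base cycle `(c, q)` is a zigzag. -/
def Seg (t : ℕ) (c q : Fin 2) (s e : ℕ) (o p : Fin 4) (a d b : ℤ) : Prop :=
  e ≤ 24 * t + 14 ∧ ∀ i, s ≤ i → i < e → base t c q i = zig o p a d b (i - s)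

/-- `u` and `v` are consecutive in one of the base cycles. -/
def Adj (t : ℕ) (u v : Option (Fin 4 × ℤ)) : Prop :=
  ∃ c q : Fin 2, ∃ i : ℕ, i < 24 * t + 14 ∧ base t c q i = u ∧
    base t c q ((i + 1) % (24 * t + 14)) = v

/-- Some base edge joins orbits `o` and `p` with difference `D` modulo `12 t + 7`. -/
def Good (t : ℕ) (o p : Fin 4) (D : ℤ) : Prop :=
  ∃ y z m : ℤ, (Adj t (some (o, y)) (some (p, z)) ∨ Adj t (some (p, z)) (some (o, y))) ∧
    z - y = D + m * (12 * t + 7)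

/-- Some base edge joins the fixed point and the orbit `o`. -/
def InfGood (t : ℕ) (o : Fin 4) : Prop :=
  ∃ y : ℤ, Adj t none (some (o, y)) ∨ Adj t (some (o, y)) none

/-- The vertex `D` of orbit `o` is on one of the two cycles of the class `c`. -/
def VGood (t : ℕ) (c : Fin 2) (o : Fin 4) (D : ℤ) : Prop :=
  ∃ q : Fin 2, ∃ i : ℕ, i < 24 * t + 14 ∧ ∃ m : ℤ,
    base t c q i = some (o, D + m * (12 * t + 7))

theorem adj_step {t : ℕ} {c q : Fin 2} {i i' : ℕ} {u v : Option (Fin 4 × ℤ)}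
    (h : i' < 24 * t + 14) (hi : i' = i + 1) (hu : base t c q i = u) (hv : base t c q i' = v) :
    Adj t u v := by
  subst hi
  exact ⟨c, q, i, by omega, hu, by rw [Nat.mod_eq_of_lt h]; exact hv⟩

theorem adj_last (t : ℕ) {c q : Fin 2} {i : ℕ} {u v : Option (Fin 4 × ℤ)}
    (hi : i + 1 = 24 * t + 14) (hu : base t c q i = u) (hv : base t c q 0 = v) :
    Adj t u v :=
  ⟨c, q, i, by omega, hu, by rw [hi, Nat.mod_self]; exact hv⟩

section
variable {t : ℕ} {c q : Fin 2} {s e : ℕ} {o p : Fin 4} {a d b : ℤ}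

theorem Seg.ev (h : Seg t c q s e o p a d b) (i : ℕ) (y : ℤ) (h1 : s ≤ i) (h2 : i < e)
    (h3 : (i - s) % 2 = 0) (h4 : a + d * (((i - s) / 2 : ℕ) : ℤ) = y) :
    base t c q i = some (o, y) := by
  rw [h.2 i h1 h2, zig, if_pos h3, h4]

theorem Seg.od (h : Seg t c q s e o p a d b) (i : ℕ) (y : ℤ) (h1 : s ≤ i) (h2 : i < e)
    (h3 : (i - s) % 2 = 1) (h4 : b - d * (((i - s) / 2 : ℕ) : ℤ) = y) :
    base t c q i = some (p, y) := by
  rw [h.2 i h1 h2, zig, if_neg (by omega), h4]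

theorem Seg.vev (h : Seg t c q s e o p a d b) {D : ℤ} (i : ℕ) (m : ℤ) (h1 : s ≤ i) (h2 : i < e)
    (h3 : (i - s) % 2 = 0) (h4 : a + d * (((i - s) / 2 : ℕ) : ℤ) = D + m * (12 * t + 7)) :
    VGood t c o D :=
  ⟨q, i, h2.trans_le h.1, m, h.ev i _ h1 h2 h3 h4⟩

theorem Seg.vod (h : Seg t c q s e o p a d b) {D : ℤ} (i : ℕ) (m : ℤ) (h1 : s ≤ i) (h2 : i < e)
    (h3 : (i - s) % 2 = 1) (h4 : b - d * (((i - s) / 2 : ℕ) : ℤ) = D + m * (12 * t + 7)) :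
    VGood t c p D :=
  ⟨q, i, h2.trans_le h.1, m, h.od i _ h1 h2 h3 h4⟩

theorem zig_adj (h : Seg t c q s e o p a d b) (i : ℕ) (h1 : s ≤ i) (h2 : i + 1 < e) :
    ∃ y z : ℤ, (Adj t (some (o, y)) (some (p, z)) ∨ Adj t (some (p, z)) (some (o, y))) ∧
      z - y = b - a - d * ((i : ℤ) - s) := by
  have hk := h.1
  obtain ⟨u, rfl⟩ := Nat.exists_eq_add_of_le h1
  rcases Nat.even_or_odd' u with ⟨j, rfl | rfl⟩
  · refine ⟨a + d * j, b - d * j, Or.inl (adj_step (i := s + 2 * j) (by omega) rfl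
      (h.ev _ _ h1 (by omega) (by omega) ?_) (h.od _ _ (by omega) h2 (by omega) ?_)), ?_⟩
    · rw [show (s + 2 * j - s) / 2 = j by omega]
    · rw [show (s + 2 * j + 1 - s) / 2 = j by omega]
    · push_cast; ring
  · refine ⟨a + d * (j + 1), b - d * j, Or.inr (adj_step (i := s + (2 * j + 1)) (by omega) rfl
      (h.od _ _ h1 (by omega) (by omega) ?_) (h.ev _ _ (by omega) h2 (by omega) ?_)), ?_⟩
    · rw [show (s + (2 * j + 1) - s) / 2 = j by omega]
    · rw [show (s + (2 * j + 1) + 1 - s) / 2 = j + 1 by omega]; push_cast; rfl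
    · push_cast; ring

theorem good_zig (h : Seg t c q s e o p a d b) {D : ℤ} (i : ℕ) (m : ℤ) (h1 : s ≤ i)
    (h2 : i + 1 < e) (h3 : b - a - d * ((i : ℤ) - s) = D + m * (12 * t + 7)) : Good t o p D := by
  obtain ⟨y, z, hA, hd⟩ := zig_adj h i h1 h2
  exact ⟨y, z, m, hA, hd.trans h3⟩

theorem good_zig_neg (h : Seg t c q s e o p a d b) {D : ℤ} (i : ℕ) (m : ℤ) (h1 : s ≤ i)
    (h2 : i + 1 < e) (h3 : -(b - a - d * ((i : ℤ) - s)) = D + m * (12 * t + 7)) :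
    Good t p o D := by
  obtain ⟨y, z, hA, hd⟩ := zig_adj h i h1 h2
  exact ⟨z, y, m, hA.symm, by rw [← h3, ← hd]; ring⟩

end

theorem seg00_0 (t : ℕ) : Seg t 0 0 (0) (6 * t + 3) 0 0 (6 * (t : ℤ) + 2) (-1) (0) := by
  refine ⟨by omega, fun i h h' => ?_⟩
  change cyc00 t i = _
  rw [cyc00, if_pos (by omega)]

theorem seg00_1 (t : ℕ) : Seg t 0 0 (6 * t + 3) (12 * t + 7) 2 2 (9 * (t : ℤ) + 3) (-1) (9 * (t : ℤ) + 4) := by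
  refine ⟨by omega, fun i h h' => ?_⟩
  change cyc00 t i = _
  rw [cyc00, if_neg (by omega), if_pos (by omega)]

theorem seg00_2 (t : ℕ) : Seg t 0 0 (12 * t + 7) (12 * t + 8) 3 3 (12 * (t : ℤ) + 5) (1) (0) := by
  refine ⟨by omega, fun i h h' => ?_⟩
  change cyc00 t i = _
  rw [cyc00, if_neg (by omega), if_neg (by omega), if_pos (by omega)]

theorem seg00_3 (t : ℕ) : Seg t 0 0 (12 * t + 8) (24 * t + 13) 1 0 (6 * (t : ℤ) + 3) (-1) (6 * (t : ℤ) + 4) := by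
  refine ⟨by omega, fun i h h' => ?_⟩
  change cyc00 t i = _
  rw [cyc00, if_neg (by omega), if_neg (by omega), if_neg (by omega), if_pos (by omega)]

theorem seg00_4 (t : ℕ) : Seg t 0 0 (24 * t + 13) (24 * t + 14) 0 0 (12 * (t : ℤ) + 6) (1) (0) := by
  refine ⟨by omega, fun i h h' => ?_⟩
  change cyc00 t i = _
  rw [cyc00, if_neg (by omega), if_neg (by omega), if_neg (by omega), if_neg (by omega)]

theorem seg01_0 (t : ℕ) : Seg t 0 1 (0) (6 * t + 2) 1 1 (6 * (t : ℤ) + 4) (1) (0) := by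
  refine ⟨by omega, fun i h h' => ?_⟩
  change cyc01 t i = _
  rw [cyc01, if_pos (by omega)]

theorem seg01_1 (t : ℕ) : Seg t 0 1 (6 * t + 2) (6 * t + 3) 1 1 (9 * (t : ℤ) + 5) (1) (0) := by
  refine ⟨by omega, fun i h h' => ?_⟩
  change cyc01 t i = _
  rw [cyc01, if_neg (by omega), if_pos (by omega)]

theorem seg01_2 (t : ℕ) : Seg t 0 1 (6 * t + 3) (6 * t + 4) 1 1 (9 * (t : ℤ) + 6) (1) (0) := by
  refine ⟨by omega, fun i h h' => ?_⟩
  change cyc01 t i = _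
  rw [cyc01, if_neg (by omega), if_neg (by omega), if_pos (by omega)]

theorem seg01_3 (t i : ℕ) (h : i = 6 * t + 4) : base t 0 1 i = none := by
  change cyc01 t i = _
  rw [cyc01, if_neg (by omega), if_neg (by omega), if_neg (by omega), if_pos (by omega)]

theorem seg01_4 (t : ℕ) : Seg t 0 1 (6 * t + 5) (12 * t + 8) 3 3 (3 * (t : ℤ)) (1) (3 * (t : ℤ) - 1) := by
  refine ⟨by omega, fun i h h' => ?_⟩
  change cyc01 t i = _
  rw [cyc01, if_neg (by omega), if_neg (by omega), if_neg (by omega), if_neg (by omega), if_pos (by omega)]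

theorem seg01_5 (t : ℕ) : Seg t 0 1 (12 * t + 8) (24 * t + 13) 3 2 (12 * (t : ℤ) + 4) (-1) (12 * (t : ℤ) + 6) := by
  refine ⟨by omega, fun i h h' => ?_⟩
  change cyc01 t i = _
  rw [cyc01, if_neg (by omega), if_neg (by omega), if_neg (by omega), if_neg (by omega), if_neg (by omega), if_pos (by omega)]

theorem seg01_6 (t : ℕ) : Seg t 0 1 (24 * t + 13) (24 * t + 14) 2 2 (6 * (t : ℤ) + 1) (1) (0) := by
  refine ⟨by omega, fun i h h' => ?_⟩
  change cyc01 t i = _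
  rw [cyc01, if_neg (by omega), if_neg (by omega), if_neg (by omega), if_neg (by omega), if_neg (by omega), if_neg (by omega)]

theorem seg10_0 (t : ℕ) : Seg t 1 0 (0) (12 * t + 5) 2 0 (12 * (t : ℤ) + 6) (-1) (6 * (t : ℤ) + 6) := by
  refine ⟨by omega, fun i h h' => ?_⟩
  change cyc10 t i = _
  rw [cyc10, if_pos (by omega)]

theorem seg10_1 (t : ℕ) : Seg t 1 0 (12 * t + 5) (12 * t + 6) 3 3 (6 * (t : ℤ) + 3) (1) (0) := by
  refine ⟨by omega, fun i h h' => ?_⟩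
  change cyc10 t i = _
  rw [cyc10, if_neg (by omega), if_pos (by omega)]

theorem seg10_2 (t : ℕ) : Seg t 1 0 (12 * t + 6) (12 * t + 7) 0 0 (6 * (t : ℤ) + 4) (1) (0) := by
  refine ⟨by omega, fun i h h' => ?_⟩
  change cyc10 t i = _
  rw [cyc10, if_neg (by omega), if_neg (by omega), if_pos (by omega)]

theorem seg10_3 (t : ℕ) : Seg t 1 0 (12 * t + 7) (24 * t + 13) 3 0 (6 * (t : ℤ) + 4) (1) (6 * (t : ℤ) + 3) := by
  refine ⟨by omega, fun i h h' => ?_⟩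
  change cyc10 t i = _
  rw [cyc10, if_neg (by omega), if_neg (by omega), if_neg (by omega), if_pos (by omega)]

theorem seg10_4 (t i : ℕ) (h : i = 24 * t + 13) : base t 1 0 i = none := by
  change cyc10 t i = _
  rw [cyc10, if_neg (by omega), if_neg (by omega), if_neg (by omega), if_neg (by omega)]

theorem seg11_0 (t : ℕ) : Seg t 1 1 (0) (12 * t + 7) 1 3 (1) (1) (6 * (t : ℤ) + 2) := by
  refine ⟨by omega, fun i h h' => ?_⟩
  change cyc11 t i = _
  rw [cyc11, if_pos (by omega)]

theorem seg11_1 (t : ℕ) : Seg t 1 1 (12 * t + 7) (12 * t + 8) 2 2 (6 * (t : ℤ) + 3) (1) (0) := by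
  refine ⟨by omega, fun i h h' => ?_⟩
  change cyc11 t i = _
  rw [cyc11, if_neg (by omega), if_pos (by omega)]

theorem seg11_2 (t : ℕ) : Seg t 1 1 (12 * t + 8) (12 * t + 9) 1 1 (6 * (t : ℤ) + 5) (1) (0) := by
  refine ⟨by omega, fun i h h' => ?_⟩
  change cyc11 t i = _
  rw [cyc11, if_neg (by omega), if_neg (by omega), if_pos (by omega)]

theorem seg11_3 (t : ℕ) : Seg t 1 1 (12 * t + 9) (12 * t + 10) 0 0 (6 * (t : ℤ) + 5) (1) (0) := by
  refine ⟨by omega, fun i h h' => ?_⟩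
  change cyc11 t i = _
  rw [cyc11, if_neg (by omega), if_neg (by omega), if_neg (by omega), if_pos (by omega)]

theorem seg11_4 (t : ℕ) : Seg t 1 1 (12 * t + 10) (24 * t + 14) 1 2 (6 * (t : ℤ) + 6) (1) (6 * (t : ℤ) + 2) := by
  refine ⟨by omega, fun i h h' => ?_⟩
  change cyc11 t i = _
  rw [cyc11, if_neg (by omega), if_neg (by omega), if_neg (by omega), if_neg (by omega)]

theorem cov00 (t : ℕ) (D : ℤ) (h0 : 1 ≤ D) (h1 : D < 12 * t + 7) : Good t 0 0 D := by
  have hd : (1 ≤ D ∧ D ≤ 6 * (t : ℤ) + 2) ∨ D = 6 * (t : ℤ) + 3 ∨ D = 6 * (t : ℤ) + 4 ∨ (6 * (t : ℤ) + 5 ≤ D ∧ D ≤ 12 * (t : ℤ) + 6) := by omega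
  rcases hd with h | h | h | h
  · exact (good_zig_neg (seg00_0 t) (6 * (t : ℤ) + 2 - D).toNat (0) (by omega) (by omega) (by omega))
  · exact ⟨_, _, -1, Or.inl (adj_last t (by omega) ((seg00_4 t).ev (24 * t + 13) (12 * (t : ℤ) + 6) (by omega) (by omega) (by omega) (by omega)) ((seg00_0 t).ev (0) (6 * (t : ℤ) + 2) (by omega) (by omega) (by omega) (by omega))), by omega⟩
  · exact ⟨_, _, 0, Or.inr (adj_last t (by omega) ((seg00_4 t).ev (24 * t + 13) (12 * (t : ℤ) + 6) (by omega) (by omega) (by omega) (by omega)) ((seg00_0 t).ev (0) (6 * (t : ℤ) + 2) (by omega) (by omega) (by omega) (by omega))), by omega⟩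
  · exact (good_zig (seg00_0 t) (-6 * (t : ℤ) - 5 + D).toNat (-1) (by omega) (by omega) (by omega))

theorem cov01 (t : ℕ) (D : ℤ) (h0 : 0 ≤ D) (h1 : D < 12 * t + 7) : Good t 0 1 D := by
  have hd : D = 0 ∨ D = 1 ∨ D = 2 ∨ (3 ≤ D ∧ D ≤ 12 * (t : ℤ) + 6) := by omega
  rcases hd with h | h | h | h
  · exact ⟨_, _, 0, Or.inr (adj_step (by omega) (by omega) ((seg11_2 t).ev (12 * t + 8) (6 * (t : ℤ) + 5) (by omega) (by omega) (by omega) (by omega)) ((seg11_3 t).ev (12 * t + 9) (6 * (t : ℤ) + 5) (by omega) (by omega) (by omega) (by omega))), by omega⟩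
  · exact ⟨_, _, 0, Or.inl (adj_step (by omega) (by omega) ((seg11_3 t).ev (12 * t + 9) (6 * (t : ℤ) + 5) (by omega) (by omega) (by omega) (by omega)) ((seg11_4 t).ev (12 * t + 10) (6 * (t : ℤ) + 6) (by omega) (by omega) (by omega) (by omega))), by omega⟩
  · exact ⟨_, _, -1, Or.inr (adj_step (by omega) (by omega) ((seg00_3 t).ev (24 * t + 12) (1) (by omega) (by omega) (by omega) (by omega)) ((seg00_4 t).ev (24 * t + 13) (12 * (t : ℤ) + 6) (by omega) (by omega) (by omega) (by omega))), by omega⟩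
  · exact (good_zig_neg (seg00_3 t) (24 * (t : ℤ) + 14 - D).toNat (-1) (by omega) (by omega) (by omega))

theorem cov02 (t : ℕ) (D : ℤ) (h0 : 0 ≤ D) (h1 : D < 12 * t + 7) : Good t 0 2 D ∨ D = 6 * t + 1 ∨ D = 6 * t + 3 := by
  by_cases hx : D = 6 * t + 1
  · exact Or.inr (Or.inl hx)
  by_cases hy : D = 6 * t + 3
  · exact Or.inr (Or.inr hy)
  left
  have hd : (-6 * (t : ℤ) - 3 ≤ D ∧ D ≤ 6 * (t : ℤ)) ∨ D = 6 * (t : ℤ) + 2 ∨ (6 * (t : ℤ) + 4 ≤ D ∧ D ≤ 18 * (t : ℤ) + 7) := by omega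
  rcases hd with h | h | h
  · exact (good_zig_neg (seg10_0 t) (6 * (t : ℤ) - D).toNat (0) (by omega) (by omega) (by omega))
  · exact ⟨_, _, 0, Or.inl (adj_step (by omega) (by omega) ((seg00_0 t).ev (6 * t + 2) (3 * (t : ℤ) + 1) (by omega) (by omega) (by omega) (by omega)) ((seg00_1 t).ev (6 * t + 3) (9 * (t : ℤ) + 3) (by omega) (by omega) (by omega) (by omega))), by omega⟩
  · exact (good_zig_neg (seg10_0 t) (18 * (t : ℤ) + 7 - D).toNat (-1) (by omega) (by omega) (by omega))

theorem cov03 (t : ℕ) (D : ℤ) (h0 : 0 ≤ D) (h1 : D < 12 * t + 7) : Good t 0 3 D := by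
  have hd : D = 0 ∨ (1 ≤ D ∧ D ≤ 12 * (t : ℤ) + 5) ∨ D = 12 * (t : ℤ) + 6 := by omega
  rcases hd with h | h | h
  · exact ⟨_, _, 0, Or.inl (adj_step (by omega) (by omega) ((seg10_2 t).ev (12 * t + 6) (6 * (t : ℤ) + 4) (by omega) (by omega) (by omega) (by omega)) ((seg10_3 t).ev (12 * t + 7) (6 * (t : ℤ) + 4) (by omega) (by omega) (by omega) (by omega))), by omega⟩
  · exact (good_zig_neg (seg10_3 t) (12 * (t : ℤ) + 6 + D).toNat (0) (by omega) (by omega) (by omega))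
  · exact ⟨_, _, -1, Or.inr (adj_step (by omega) (by omega) ((seg10_1 t).ev (12 * t + 5) (6 * (t : ℤ) + 3) (by omega) (by omega) (by omega) (by omega)) ((seg10_2 t).ev (12 * t + 6) (6 * (t : ℤ) + 4) (by omega) (by omega) (by omega) (by omega))), by omega⟩

theorem cov11 (t : ℕ) (D : ℤ) (h0 : 1 ≤ D) (h1 : D < 12 * t + 7) : Good t 1 1 D := by
  have hd : D = 1 ∨ D = 2 ∨ (3 ≤ D ∧ D ≤ 6 * (t : ℤ) + 3) ∨ (6 * (t : ℤ) + 4 ≤ D ∧ D ≤ 12 * (t : ℤ) + 4) ∨ D = 12 * (t : ℤ) + 5 ∨ D = 12 * (t : ℤ) + 6 := by omega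
  rcases hd with h | h | h | h | h | h
  · exact ⟨_, _, 0, Or.inl (adj_step (by omega) (by omega) ((seg01_1 t).ev (6 * t + 2) (9 * (t : ℤ) + 5) (by omega) (by omega) (by omega) (by omega)) ((seg01_2 t).ev (6 * t + 3) (9 * (t : ℤ) + 6) (by omega) (by omega) (by omega) (by omega))), by omega⟩
  · exact ⟨_, _, -1, Or.inr (adj_step (by omega) (by omega) ((seg01_0 t).od (6 * t + 1) (-3 * (t : ℤ)) (by omega) (by omega) (by omega) (by omega)) ((seg01_1 t).ev (6 * t + 2) (9 * (t : ℤ) + 5) (by omega) (by omega) (by omega) (by omega))), by omega⟩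
  · exact (good_zig (seg01_0 t) (6 * (t : ℤ) + 3 - D).toNat (-1) (by omega) (by omega) (by omega))
  · exact (good_zig_neg (seg01_0 t) (-6 * (t : ℤ) - 4 + D).toNat (0) (by omega) (by omega) (by omega))
  · exact ⟨_, _, 0, Or.inl (adj_step (by omega) (by omega) ((seg01_0 t).od (6 * t + 1) (-3 * (t : ℤ)) (by omega) (by omega) (by omega) (by omega)) ((seg01_1 t).ev (6 * t + 2) (9 * (t : ℤ) + 5) (by omega) (by omega) (by omega) (by omega))), by omega⟩
  · exact ⟨_, _, -1, Or.inr (adj_step (by omega) (by omega) ((seg01_1 t).ev (6 * t + 2) (9 * (t : ℤ) + 5) (by omega) (by omega) (by omega) (by omega)) ((seg01_2 t).ev (6 * t + 3) (9 * (t : ℤ) + 6) (by omega) (by omega) (by omega) (by omega))), by omega⟩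

theorem cov12 (t : ℕ) (D : ℤ) (h0 : 0 ≤ D) (h1 : D < 12 * t + 7) : Good t 1 2 D := by
  have hd : D = 0 ∨ (1 ≤ D ∧ D ≤ 12 * (t : ℤ) + 3) ∨ D = 12 * (t : ℤ) + 4 ∨ D = 12 * (t : ℤ) + 5 ∨ D = 12 * (t : ℤ) + 6 := by omega
  rcases hd with h | h | h | h | h
  · exact ⟨_, _, 0, Or.inr (adj_last t (by omega) ((seg11_4 t).od (24 * t + 13) (1) (by omega) (by omega) (by omega) (by omega)) ((seg11_0 t).ev (0) (1) (by omega) (by omega) (by omega) (by omega))), by omega⟩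
  · exact (good_zig (seg11_4 t) (24 * (t : ℤ) + 13 - D).toNat (-1) (by omega) (by omega) (by omega))
  · exact ⟨_, _, -1, Or.inr (adj_last t (by omega) ((seg01_6 t).ev (24 * t + 13) (6 * (t : ℤ) + 1) (by omega) (by omega) (by omega) (by omega)) ((seg01_0 t).ev (0) (6 * (t : ℤ) + 4) (by omega) (by omega) (by omega) (by omega))), by omega⟩
  · exact ⟨_, _, -1, Or.inr (adj_step (by omega) (by omega) ((seg11_1 t).ev (12 * t + 7) (6 * (t : ℤ) + 3) (by omega) (by omega) (by omega) (by omega)) ((seg11_2 t).ev (12 * t + 8) (6 * (t : ℤ) + 5) (by omega) (by omega) (by omega) (by omega))), by omega⟩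
  · exact ⟨_, _, -1, Or.inl (adj_step (by omega) (by omega) ((seg11_0 t).ev (12 * t + 6) (6 * (t : ℤ) + 4) (by omega) (by omega) (by omega) (by omega)) ((seg11_1 t).ev (12 * t + 7) (6 * (t : ℤ) + 3) (by omega) (by omega) (by omega) (by omega))), by omega⟩

theorem cov13 (t : ℕ) (D : ℤ) (h0 : 0 ≤ D) (h1 : D < 12 * t + 7) : Good t 1 3 D := by
  have hd : (-6 * (t : ℤ) - 4 ≤ D ∧ D ≤ 6 * (t : ℤ) + 1) ∨ D = 6 * (t : ℤ) + 2 ∨ (6 * (t : ℤ) + 3 ≤ D ∧ D ≤ 18 * (t : ℤ) + 8) := by omega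
  rcases hd with h | h | h
  · exact (good_zig (seg11_0 t) (6 * (t : ℤ) + 1 - D).toNat (0) (by omega) (by omega) (by omega))
  · exact ⟨_, _, 0, Or.inr (adj_step (by omega) (by omega) ((seg00_2 t).ev (12 * t + 7) (12 * (t : ℤ) + 5) (by omega) (by omega) (by omega) (by omega)) ((seg00_3 t).ev (12 * t + 8) (6 * (t : ℤ) + 3) (by omega) (by omega) (by omega) (by omega))), by omega⟩
  · exact (good_zig (seg11_0 t) (18 * (t : ℤ) + 8 - D).toNat (-1) (by omega) (by omega) (by omega))

theorem cov22 (t : ℕ) (D : ℤ) (h0 : 1 ≤ D) (h1 : D < 12 * t + 7) : Good t 2 2 D := by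
  have hd : (1 ≤ D ∧ D ≤ 6 * (t : ℤ) + 3) ∨ (6 * (t : ℤ) + 4 ≤ D ∧ D ≤ 12 * (t : ℤ) + 6) := by omega
  rcases hd with h | h
  · exact (good_zig (seg00_1 t) (6 * (t : ℤ) + 2 + D).toNat (0) (by omega) (by omega) (by omega))
  · exact (good_zig_neg (seg00_1 t) (18 * (t : ℤ) + 9 - D).toNat (-1) (by omega) (by omega) (by omega))

theorem cov23 (t : ℕ) (D : ℤ) (h0 : 0 ≤ D) (h1 : D < 12 * t + 7) : Good t 2 3 D := by
  have hd : D = 0 ∨ D = 1 ∨ (2 ≤ D ∧ D ≤ 12 * (t : ℤ) + 5) ∨ D = 12 * (t : ℤ) + 6 := by omega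
  rcases hd with h | h | h | h
  · exact ⟨_, _, 0, Or.inl (adj_step (by omega) (by omega) ((seg00_1 t).od (12 * t + 6) (12 * (t : ℤ) + 5) (by omega) (by omega) (by omega) (by omega)) ((seg00_2 t).ev (12 * t + 7) (12 * (t : ℤ) + 5) (by omega) (by omega) (by omega) (by omega))), by omega⟩
  · exact ⟨_, _, 0, Or.inr (adj_step (by omega) (by omega) ((seg01_5 t).ev (24 * t + 12) (6 * (t : ℤ) + 2) (by omega) (by omega) (by omega) (by omega)) ((seg01_6 t).ev (24 * t + 13) (6 * (t : ℤ) + 1) (by omega) (by omega) (by omega) (by omega))), by omega⟩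
  · exact (good_zig_neg (seg01_5 t) (24 * (t : ℤ) + 13 - D).toNat (-1) (by omega) (by omega) (by omega))
  · exact ⟨_, _, -1, Or.inl (adj_step (by omega) (by omega) ((seg10_0 t).ev (12 * t + 4) (6 * (t : ℤ) + 4) (by omega) (by omega) (by omega) (by omega)) ((seg10_1 t).ev (12 * t + 5) (6 * (t : ℤ) + 3) (by omega) (by omega) (by omega) (by omega))), by omega⟩

theorem cov33 (t : ℕ) (D : ℤ) (h0 : 1 ≤ D) (h1 : D < 12 * t + 7) : Good t 3 3 D := by
  have hd : (1 ≤ D ∧ D ≤ 6 * (t : ℤ) + 2) ∨ D = 6 * (t : ℤ) + 3 ∨ D = 6 * (t : ℤ) + 4 ∨ (6 * (t : ℤ) + 5 ≤ D ∧ D ≤ 12 * (t : ℤ) + 6) := by omega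
  rcases hd with h | h | h | h
  · exact (good_zig_neg (seg01_4 t) (6 * (t : ℤ) + 4 + D).toNat (0) (by omega) (by omega) (by omega))
  · exact ⟨_, _, 0, Or.inl (adj_step (by omega) (by omega) ((seg01_4 t).ev (12 * t + 7) (6 * (t : ℤ) + 1) (by omega) (by omega) (by omega) (by omega)) ((seg01_5 t).ev (12 * t + 8) (12 * (t : ℤ) + 4) (by omega) (by omega) (by omega) (by omega))), by omega⟩
  · exact ⟨_, _, -1, Or.inr (adj_step (by omega) (by omega) ((seg01_4 t).ev (12 * t + 7) (6 * (t : ℤ) + 1) (by omega) (by omega) (by omega) (by omega)) ((seg01_5 t).ev (12 * t + 8) (12 * (t : ℤ) + 4) (by omega) (by omega) (by omega) (by omega))), by omega⟩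
  · exact (good_zig (seg01_4 t) (18 * (t : ℤ) + 11 - D).toNat (-1) (by omega) (by omega) (by omega))

theorem covInf (t : ℕ) : ∀ o : Fin 4, InfGood t o
  | 0 => ⟨1, Or.inr (adj_step (by omega) (by omega) ((seg10_3 t).od (24 * t + 12) (1) (by omega) (by omega) (by omega) (by omega)) (seg10_4 t (24 * t + 13) (by omega)))⟩
  | 1 => ⟨9 * (t : ℤ) + 6, Or.inr (adj_step (by omega) (by omega) ((seg01_2 t).ev (6 * t + 3) (9 * (t : ℤ) + 6) (by omega) (by omega) (by omega) (by omega)) (seg01_3 t (6 * t + 4) (by omega)))⟩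
  | 2 => ⟨12 * (t : ℤ) + 6, Or.inl (adj_last t (by omega) (seg10_4 t (24 * t + 13) (by omega)) ((seg10_0 t).ev (0) (12 * (t : ℤ) + 6) (by omega) (by omega) (by omega) (by omega)))⟩
  | 3 => ⟨3 * (t : ℤ), Or.inl (adj_step (by omega) (by omega) (seg01_3 t (6 * t + 4) (by omega)) ((seg01_4 t).ev (6 * t + 5) (3 * (t : ℤ)) (by omega) (by omega) (by omega) (by omega)))⟩

theorem vcov00 (t : ℕ) (D : ℤ) (h0 : 0 ≤ D) (h1 : D < 12 * t + 7) (hm : D ≠ 6 * (t : ℤ) + 3) : VGood t 0 0 D := by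
  have hd : (0 ≤ D ∧ D ≤ 3 * (t : ℤ)) ∨ (3 * (t : ℤ) + 1 ≤ D ∧ D ≤ 6 * (t : ℤ) + 2) ∨ (6 * (t : ℤ) + 4 ≤ D ∧ D ≤ 12 * (t : ℤ) + 5) ∨ D = 12 * (t : ℤ) + 6 := by omega
  rcases hd with h | h | h | h
  · exact (seg00_0 t).vod (1 + 2 * D).toNat (0) (by omega) (by omega) (by omega) (by omega)
  · exact (seg00_0 t).vev (12 * (t : ℤ) + 4 - 2 * D).toNat (0) (by omega) (by omega) (by omega) (by omega)
  · exact (seg00_3 t).vod (1 + 2 * D).toNat (0) (by omega) (by omega) (by omega) (by omega)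
  · exact (seg00_4 t).vev (1 + 2 * D).toNat (0) (by omega) (by omega) (by omega) (by omega)

theorem vcov01 (t : ℕ) (D : ℤ) (h0 : 0 ≤ D) (h1 : D < 12 * t + 7) : VGood t 0 1 D := by
  have hd : (-3 * (t : ℤ) ≤ D ∧ D ≤ 0) ∨ (1 ≤ D ∧ D ≤ 6 * (t : ℤ) + 3) ∨ (6 * (t : ℤ) + 4 ≤ D ∧ D ≤ 9 * (t : ℤ) + 4) ∨ D = 9 * (t : ℤ) + 5 ∨ D = 9 * (t : ℤ) + 6 ∨ (9 * (t : ℤ) + 7 ≤ D ∧ D ≤ 12 * (t : ℤ) + 7) := by omega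
  rcases hd with h | h | h | h | h | h
  · exact (seg01_0 t).vod (1 - 2 * D).toNat (0) (by omega) (by omega) (by omega) (by omega)
  · exact (seg00_3 t).vev (24 * (t : ℤ) + 14 - 2 * D).toNat (0) (by omega) (by omega) (by omega) (by omega)
  · exact (seg01_0 t).vev (-12 * (t : ℤ) - 8 + 2 * D).toNat (0) (by omega) (by omega) (by omega) (by omega)
  · exact (seg01_1 t).vev (-12 * (t : ℤ) - 8 + 2 * D).toNat (0) (by omega) (by omega) (by omega) (by omega)
  · exact (seg01_2 t).vev (-12 * (t : ℤ) - 9 + 2 * D).toNat (0) (by omega) (by omega) (by omega) (by omega)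
  · exact (seg01_0 t).vod (24 * (t : ℤ) + 15 - 2 * D).toNat (-1) (by omega) (by omega) (by omega) (by omega)

theorem vcov02 (t : ℕ) (D : ℤ) (h0 : 0 ≤ D) (h1 : D < 12 * t + 7) : VGood t 0 2 D := by
  have hd : (-1 ≤ D ∧ D ≤ 6 * (t : ℤ)) ∨ D = 6 * (t : ℤ) + 1 ∨ (6 * (t : ℤ) + 2 ≤ D ∧ D ≤ 9 * (t : ℤ) + 3) ∨ (9 * (t : ℤ) + 4 ≤ D ∧ D ≤ 12 * (t : ℤ) + 5) ∨ (12 * (t : ℤ) + 6 ≤ D ∧ D ≤ 18 * (t : ℤ) + 7) := by omega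
  rcases hd with h | h | h | h | h
  · exact (seg01_5 t).vod (12 * (t : ℤ) + 11 + 2 * D).toNat (1) (by omega) (by omega) (by omega) (by omega)
  · exact (seg01_6 t).vev (12 * (t : ℤ) + 11 + 2 * D).toNat (0) (by omega) (by omega) (by omega) (by omega)
  · exact (seg00_1 t).vev (24 * (t : ℤ) + 9 - 2 * D).toNat (0) (by omega) (by omega) (by omega) (by omega)
  · exact (seg00_1 t).vod (-12 * (t : ℤ) - 4 + 2 * D).toNat (0) (by omega) (by omega) (by omega) (by omega)
  · exact (seg01_5 t).vod (-12 * (t : ℤ) - 3 + 2 * D).toNat (0) (by omega) (by omega) (by omega) (by omega)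

theorem vcov03 (t : ℕ) (D : ℤ) (h0 : 0 ≤ D) (h1 : D < 12 * t + 7) : VGood t 0 3 D := by
  have hd : (-1 ≤ D ∧ D ≤ 3 * (t : ℤ) - 1) ∨ (3 * (t : ℤ) ≤ D ∧ D ≤ 6 * (t : ℤ) + 1) ∨ (6 * (t : ℤ) + 2 ≤ D ∧ D ≤ 12 * (t : ℤ) + 4) ∨ D = 12 * (t : ℤ) + 5 ∨ (12 * (t : ℤ) + 6 ≤ D ∧ D ≤ 15 * (t : ℤ) + 6) := by omega
  rcases hd with h | h | h | h | h
  · exact (seg01_4 t).vod (12 * (t : ℤ) + 4 - 2 * D).toNat (0) (by omega) (by omega) (by omega) (by omega)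
  · exact (seg01_4 t).vev (5 + 2 * D).toNat (0) (by omega) (by omega) (by omega) (by omega)
  · exact (seg01_5 t).vev (36 * (t : ℤ) + 16 - 2 * D).toNat (0) (by omega) (by omega) (by omega) (by omega)
  · exact (seg00_2 t).vev (-12 * (t : ℤ) - 3 + 2 * D).toNat (0) (by omega) (by omega) (by omega) (by omega)
  · exact (seg01_4 t).vod (36 * (t : ℤ) + 18 - 2 * D).toNat (-1) (by omega) (by omega) (by omega) (by omega)

theorem vcov10 (t : ℕ) (D : ℤ) (h0 : 0 ≤ D) (h1 : D < 12 * t + 7) : VGood t 1 0 D := by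
  have hd : (-6 * (t : ℤ) - 1 ≤ D ∧ D ≤ 0) ∨ (1 ≤ D ∧ D ≤ 6 * (t : ℤ) + 3) ∨ D = 6 * (t : ℤ) + 4 ∨ D = 6 * (t : ℤ) + 5 ∨ (6 * (t : ℤ) + 6 ≤ D ∧ D ≤ 12 * (t : ℤ) + 7) := by omega
  rcases hd with h | h | h | h | h
  · exact (seg10_0 t).vod (12 * (t : ℤ) + 3 + 2 * D).toNat (1) (by omega) (by omega) (by omega) (by omega)
  · exact (seg10_3 t).vod (24 * (t : ℤ) + 14 - 2 * D).toNat (0) (by omega) (by omega) (by omega) (by omega)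
  · exact (seg10_2 t).vev (-2 + 2 * D).toNat (0) (by omega) (by omega) (by omega) (by omega)
  · exact (seg11_3 t).vev (-1 + 2 * D).toNat (0) (by omega) (by omega) (by omega) (by omega)
  · exact (seg10_0 t).vod (-12 * (t : ℤ) - 11 + 2 * D).toNat (0) (by omega) (by omega) (by omega) (by omega)

theorem vcov11 (t : ℕ) (D : ℤ) (h0 : 0 ≤ D) (h1 : D < 12 * t + 7) : VGood t 1 1 D := by
  have hd : (-6 * (t : ℤ) - 1 ≤ D ∧ D ≤ 0) ∨ (1 ≤ D ∧ D ≤ 6 * (t : ℤ) + 4) ∨ D = 6 * (t : ℤ) + 5 ∨ (6 * (t : ℤ) + 6 ≤ D ∧ D ≤ 12 * (t : ℤ) + 7) := by omega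
  rcases hd with h | h | h | h
  · exact (seg11_4 t).vev (24 * (t : ℤ) + 12 + 2 * D).toNat (1) (by omega) (by omega) (by omega) (by omega)
  · exact (seg11_0 t).vev (-2 + 2 * D).toNat (0) (by omega) (by omega) (by omega) (by omega)
  · exact (seg11_2 t).vev (-2 + 2 * D).toNat (0) (by omega) (by omega) (by omega) (by omega)
  · exact (seg11_4 t).vev (-2 + 2 * D).toNat (0) (by omega) (by omega) (by omega) (by omega)

theorem vcov12 (t : ℕ) (D : ℤ) (h0 : 0 ≤ D) (h1 : D < 12 * t + 7) (hm : D ≠ 0) : VGood t 1 2 D := by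
  have hd : (1 ≤ D ∧ D ≤ 6 * (t : ℤ) + 2) ∨ D = 6 * (t : ℤ) + 3 ∨ (6 * (t : ℤ) + 4 ≤ D ∧ D ≤ 12 * (t : ℤ) + 6) := by omega
  rcases hd with h | h | h
  · exact (seg11_4 t).vod (24 * (t : ℤ) + 15 - 2 * D).toNat (0) (by omega) (by omega) (by omega) (by omega)
  · exact (seg11_1 t).vev (1 + 2 * D).toNat (0) (by omega) (by omega) (by omega) (by omega)
  · exact (seg10_0 t).vev (24 * (t : ℤ) + 12 - 2 * D).toNat (0) (by omega) (by omega) (by omega) (by omega)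

theorem vcov13 (t : ℕ) (D : ℤ) (h0 : 0 ≤ D) (h1 : D < 12 * t + 7) : VGood t 1 3 D := by
  have hd : (0 ≤ D ∧ D ≤ 6 * (t : ℤ) + 2) ∨ D = 6 * (t : ℤ) + 3 ∨ (6 * (t : ℤ) + 4 ≤ D ∧ D ≤ 12 * (t : ℤ) + 6) := by omega
  rcases hd with h | h | h
  · exact (seg11_0 t).vod (12 * (t : ℤ) + 5 - 2 * D).toNat (0) (by omega) (by omega) (by omega) (by omega)
  · exact (seg10_1 t).vev (-1 + 2 * D).toNat (0) (by omega) (by omega) (by omega) (by omega)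
  · exact (seg10_3 t).vev (-1 + 2 * D).toNat (0) (by omega) (by omega) (by omega) (by omega)

theorem infv0 (t : ℕ) : ∃ q : Fin 2, ∃ i : ℕ, i < 24 * t + 14 ∧ base t 0 q i = none :=
  ⟨1, 6 * t + 4, by omega, seg01_3 t _ (by omega)⟩

theorem infv1 (t : ℕ) : ∃ q : Fin 2, ∃ i : ℕ, i < 24 * t + 14 ∧ base t 1 q i = none :=
  ⟨0, 24 * t + 13, by omega, seg10_4 t _ (by omega)⟩

/-! ### From the base cycles to the cycle system -/

theorem hasARCS_of {V I : Type} [Fintype V] [DecidableEq V] [Fintype I] {k : ℕ} [NeZero k]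
    (hV : Fintype.card V = 2 * k + 1) (hI : Fintype.card I = k)
    (A : I → Fin 2 → ZMod k → V) (h : ZMod k → V)
    (hA : ∀ i, ∃ m, ∀ x, x ≠ m → ∃ j a, A i j a = x) (hh : Function.Injective h)
    (hE : ∀ x y : V, x ≠ y → (∃ i j a, s(x, y) = s(A i j a, A i j (a + 1))) ∨
      ∃ a, s(x, y) = s(h a, h (a + 1))) :
    HasARCS k (2 * k + 1) := by
  have hk : 0 < k := Nat.pos_of_ne_zero (NeZero.ne k)
  have e1 : (2 * k + 1 - 1) / 2 = k := by omega
  have e2 : (2 * k + 1 - 1) / k = 2 := by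
    rw [Nat.add_sub_cancel]; exact Nat.mul_div_cancel _ hk
  have e3 : (2 * k + 1 - 1) / (2 * k) = 1 := by
    rw [Nat.add_sub_cancel]; exact Nat.div_self (by omega)
  unfold HasARCS
  rw [e1, e2, e3]
  let eV : V ≃ Fin (2 * k + 1) := Fintype.equivFinOfCardEq hV
  let eI : Fin k ≃ I := (Fintype.equivFinOfCardEq hI).symm
  -- injectivity within a class, by counting
  have hinj : ∀ i, Function.Injective (fun p : Fin 2 × ZMod k => A i p.1 p.2) := by
    intro i
    obtain ⟨m, hm⟩ := hA i
    have hsub : Finset.univ.erase m ⊆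
        Finset.univ.image (fun p : Fin 2 × ZMod k => A i p.1 p.2) := by
      intro x hx
      obtain ⟨j, a, rfl⟩ := hm x (Finset.ne_of_mem_erase hx)
      exact Finset.mem_image.2 ⟨(j, a), Finset.mem_univ _, rfl⟩
    have hc := Finset.card_le_card hsub
    rw [Finset.card_erase_of_mem (Finset.mem_univ _), Finset.card_univ, hV] at hc
    have hle := Finset.card_image_le (s := Finset.univ)
      (f := fun p : Fin 2 × ZMod k => A i p.1 p.2)
    have hu : (Finset.univ : Finset (Fin 2 × ZMod k)).card = 2 * k := by
      rw [Finset.card_univ, Fintype.card_prod, Fintype.card_fin, ZMod.card]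
    have := Finset.injOn_of_card_image_eq (s := Finset.univ)
      (f := fun p : Fin 2 × ZMod k => A i p.1 p.2) (by omega)
    intro x y hxy
    exact this (Finset.mem_coe.2 (Finset.mem_univ _)) (Finset.mem_coe.2 (Finset.mem_univ _)) hxy
  -- the edge map
  let C : (Fin k × Fin 2) ⊕ Fin 1 → ZMod k → V :=
    Sum.elim (fun q => A (eI q.1) q.2) (fun _ => h)
  let Φ : ((Fin k × Fin 2) ⊕ Fin 1) × ZMod k → Sym2 V := fun p => s(C p.1 p.2, C p.1 (p.2 + 1))
  have hcov : ∀ x y : V, x ≠ y → ∃ p, s(x, y) = Φ p := by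
    intro x y hxy
    rcases hE x y hxy with ⟨i, j, a, ha⟩ | ⟨a, ha⟩
    · exact ⟨(Sum.inl (eI.symm i, j), a), by simpa [Φ, C] using ha⟩
    · exact ⟨(Sum.inr 0, a), by simpa [Φ, C] using ha⟩
  have hΦ : Function.Injective Φ := by
    have hsub : (Finset.univ.filter fun e : Sym2 V => ¬ e.IsDiag) ⊆ Finset.univ.image Φ := by
      intro e he
      induction e using Sym2.ind with
      | _ x y =>
        have hxy : x ≠ y := by simpa using he
        obtain ⟨p, hp⟩ := hcov x y hxy
        exact Finset.mem_image.2 ⟨p, Finset.mem_univ _, hp.symm⟩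
    have hc := Finset.card_le_card hsub
    rw [← Fintype.card_subtype, Sym2.card_subtype_not_diag, hV, Nat.choose_two_right,
      Nat.add_sub_cancel, show (2 * k + 1) * (2 * k) = (2 * k + 1) * k * 2 by ring,
      Nat.mul_div_cancel _ (by norm_num)] at hc
    have hle := Finset.card_image_le (s := Finset.univ) (f := Φ)
    have hu : (Finset.univ : Finset (((Fin k × Fin 2) ⊕ Fin 1) × ZMod k)).card
        = (2 * k + 1) * k := by
      rw [Finset.card_univ, Fintype.card_prod, Fintype.card_sum, Fintype.card_prod,
        Fintype.card_fin, Fintype.card_fin, Fintype.card_fin, ZMod.card]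
      ring
    have := Finset.injOn_of_card_image_eq (s := Finset.univ) (f := Φ) (by omega)
    intro x y hxy
    exact this (Finset.mem_coe.2 (Finset.mem_univ _)) (Finset.mem_coe.2 (Finset.mem_univ _)) hxy
  refine ⟨fun i j a => eV (A (eI i) j a), fun _ a => eV (h a), ?_, ?_, ?_, ?_, ?_⟩
  · intro i j a b hab
    have := @hinj (eI i) (j, a) (j, b) (eV.injective hab)
    exact (Prod.mk.inj this).2
  · intro _ a b hab
    exact hh (eV.injective hab)
  · intro i j₁ j₂ hne
    rw [Set.disjoint_left]
    rintro _ ⟨a, rfl⟩ ⟨b, hb⟩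
    have := @hinj (eI i) (j₂, b) (j₁, a) (eV.injective hb)
    exact hne (Prod.mk.inj this).1.symm
  · intro j₁ j₂ hne
    exact absurd (Subsingleton.elim _ _) hne
  · -- membership of an edge in a cycle, in terms of `Φ`
    have hmem : ∀ (x y : V) (p : (Fin k × Fin 2) ⊕ Fin 1),
        s(eV x, eV y) ∈ Sum.elim
          (fun q : Fin k × Fin 2 => cycleEdgeSet (fun a => eV (A (eI q.1) q.2 a)))
          (fun _ : Fin 1 => cycleEdgeSet (fun a => eV (h a))) p ↔
        ∃ a, s(x, y) = Φ (p, a) := by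
      have hmap : ∀ x y u v : V, s(eV x, eV y) = s(eV u, eV v) ↔ s(x, y) = s(u, v) := by
        intro x y u v
        simp [Sym2.eq_iff]
      intro x y p
      rcases p with q | j
      · exact exists_congr fun a => hmap _ _ _ _
      · exact exists_congr fun a => hmap _ _ _ _
    intro e he
    induction e using Sym2.ind with
    | _ x' y' =>
      obtain ⟨x, rfl⟩ := eV.surjective x'
      obtain ⟨y, rfl⟩ := eV.surjective y'
      have hxy : x ≠ y := fun hxy => he (by rw [hxy]; simp)
      obtain ⟨⟨p, a⟩, hp⟩ := hcov x y hxy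
      refine ⟨p, (hmem x y p).2 ⟨a, hp⟩, ?_⟩
      intro p' hp'
      obtain ⟨a', ha'⟩ := (hmem x y p').1 hp'
      exact (Prod.mk.inj (hΦ (ha'.symm.trans hp))).1

/-- The vertices: a fixed point and four copies of `ZMod (12 t + 7)`. -/
abbrev Vert (t : ℕ) : Type := Option (Fin 4 × ZMod (12 * t + 7))

/-- Reduce modulo `12 t + 7` and translate by `s`. -/
def shift (t : ℕ) (s : ZMod (12 * t + 7)) : Option (Fin 4 × ℤ) → Vert t :=
  Option.map fun x => (x.1, (x.2 : ZMod (12 * t + 7)) + s)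

/-- The cycles of the almost parallel classes. -/
def apCyc (t : ℕ) (i : Fin 2 × ZMod (12 * t + 7)) (j : Fin 2) (a : ZMod (24 * t + 14)) : Vert t :=
  shift t i.2 (base t i.1 j a.val)

/-- The cycle of the half-parallel class. -/
def hpCyc (t : ℕ) (a : ZMod (24 * t + 14)) : Vert t :=
  if a.val % 2 = 0 then some (0, (a.val : ZMod (12 * t + 7)))
  else some (2, (a.val : ZMod (12 * t + 7)) + (6 * t + 2 : ℕ))

theorem cast_n (t : ℕ) : (12 * (t : ZMod (12 * t + 7)) + 7) = 0 := by
  have := ZMod.natCast_self (12 * t + 7)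
  push_cast at this
  exact this

theorem exists_rep (t : ℕ) (x : ZMod (12 * t + 7)) :
    ∃ D : ℤ, 0 ≤ D ∧ D < 12 * t + 7 ∧ (D : ZMod (12 * t + 7)) = x := by
  have : NeZero (12 * t + 7) := ⟨by omega⟩
  refine ⟨(x.val : ℤ), by omega, ?_, by simp⟩
  have := ZMod.val_lt x
  omega

/-- Adjacency in the cycle system, as unordered pairs. -/
def Covered (t : ℕ) (x y : Vert t) : Prop :=
  (∃ i j a, s(x, y) = s(apCyc t i j a, apCyc t i j (a + 1))) ∨
    ∃ a, s(x, y) = s(hpCyc t a, hpCyc t (a + 1))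

theorem Covered.symm {t : ℕ} {x y : Vert t} (h : Covered t x y) : Covered t y x := by
  unfold Covered at *
  rwa [Sym2.eq_swap]

theorem covered_of_adj {t : ℕ} {u v : Option (Fin 4 × ℤ)} (h : Adj t u v)
    (s : ZMod (12 * t + 7)) : Covered t (shift t s u) (shift t s v) := by
  obtain ⟨c, q, i, hi, rfl, rfl⟩ := h
  have : NeZero (24 * t + 14) := ⟨by omega⟩
  refine Or.inl ⟨(c, s), q, (i : ZMod (24 * t + 14)), ?_⟩
  have h1 : ((i : ZMod (24 * t + 14))).val = i := by
    rw [ZMod.val_natCast, Nat.mod_eq_of_lt hi]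
  have h2 : ((i : ZMod (24 * t + 14)) + 1).val = (i + 1) % (24 * t + 14) := by
    rw [← ZMod.val_natCast]; push_cast; rfl
  unfold apCyc
  rw [h1, h2]

theorem covered_of_good {t : ℕ} {o p : Fin 4} {D : ℤ} (h : Good t o p D)
    {x z : ZMod (12 * t + 7)} (hD : (D : ZMod (12 * t + 7)) = z - x) :
    Covered t (some (o, x)) (some (p, z)) := by
  obtain ⟨y, w, m, hA, hm⟩ := h
  have hm' : (w : ZMod (12 * t + 7)) - y = z - x := by
    have := congrArg (fun r : ℤ => (r : ZMod (12 * t + 7))) hm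
    push_cast at this
    rw [this, cast_n, hD]; ring
  have e1 : shift t (x - y) (some (o, y)) = some (o, x) := by
    simp [shift]
  have e2 : shift t (x - y) (some (p, w)) = some (p, z) := by
    have : (w : ZMod (12 * t + 7)) + (x - y) = z := by linear_combination hm'
    simp [shift, this]
  rw [← e1, ← e2]
  rcases hA with hA | hA
  · exact covered_of_adj hA _
  · exact (covered_of_adj hA _).symm

theorem covered_of_infGood {t : ℕ} {o : Fin 4} (h : InfGood t o) (x : ZMod (12 * t + 7)) :
    Covered t none (some (o, x)) := by
  obtain ⟨y, hA⟩ := h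
  have e1 : shift t (x - y) (some (o, y)) = some (o, x) := by
    simp [shift]
  have e2 : shift t (x - y) none = none := rfl
  rw [← e1, ← e2]
  rcases hA with hA | hA
  · exact covered_of_adj hA _
  · exact (covered_of_adj hA _).symm

/-- Every element of `ZMod (12 t + 7)` is `2 j` for some `j < 12 t + 7`. -/
theorem exists_half (t : ℕ) (x : ZMod (12 * t + 7)) :
    ∃ j : ℕ, j < 12 * t + 7 ∧ ((2 * j : ℕ) : ZMod (12 * t + 7)) = x := by
  have : NeZero (12 * t + 7) := ⟨by omega⟩
  have hx := ZMod.val_lt x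
  rcases Nat.even_or_odd' x.val with ⟨j, hj | hj⟩
  · exact ⟨j, by omega, by rw [← hj]; simp⟩
  · refine ⟨j + (6 * t + 4), by omega, ?_⟩
    rw [show 2 * (j + (6 * t + 4)) = x.val + (12 * t + 7) by omega]
    rw [Nat.cast_add, ZMod.natCast_self]; simp

theorem hpCyc_nat (t i : ℕ) (hi : i < 24 * t + 14) : hpCyc t (i : ZMod (24 * t + 14)) =
    if i % 2 = 0 then some (0, (i : ZMod (12 * t + 7)))
    else some (2, (i : ZMod (12 * t + 7)) + (6 * t + 2 : ℕ)) := by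
  unfold hpCyc
  rw [ZMod.val_natCast, Nat.mod_eq_of_lt hi]

theorem covered_hp1 (t : ℕ) {x z : ZMod (12 * t + 7)}
    (h : ((6 * t + 3 : ℤ) : ZMod (12 * t + 7)) = z - x) :
    Covered t (some (0, x)) (some (2, z)) := by
  obtain ⟨j, hj, rfl⟩ := exists_half t x
  have hz : z = ((2 * j + 1 : ℕ) : ZMod (12 * t + 7)) + (6 * t + 2 : ℕ) := by
    push_cast at h ⊢
    linear_combination -h
  refine Or.inr ⟨((2 * j : ℕ) : ZMod (24 * t + 14)), ?_⟩
  rw [show ((2 * j : ℕ) : ZMod (24 * t + 14)) + 1 = ((2 * j + 1 : ℕ) : ZMod (24 * t + 14)) by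
    push_cast; rfl, hpCyc_nat t _ (by omega), hpCyc_nat t _ (by omega), if_pos (by omega),
    if_neg (by omega), hz]

theorem covered_hp2 (t : ℕ) {x z : ZMod (12 * t + 7)}
    (h : ((6 * t + 1 : ℤ) : ZMod (12 * t + 7)) = z - x) :
    Covered t (some (0, x)) (some (2, z)) := by
  obtain ⟨j, hj, hx⟩ := exists_half t (x - 2)
  have hx' : x = ((2 * j + 2 : ℕ) : ZMod (12 * t + 7)) := by
    push_cast at hx ⊢
    linear_combination -hx
  have hz : z = ((2 * j + 1 : ℕ) : ZMod (12 * t + 7)) + (6 * t + 2 : ℕ) := by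
    push_cast at h hx ⊢
    linear_combination -h - hx
  refine Covered.symm (Or.inr ⟨((2 * j + 1 : ℕ) : ZMod (24 * t + 14)), ?_⟩)
  rw [show ((2 * j + 1 : ℕ) : ZMod (24 * t + 14)) + 1 = ((2 * j + 2 : ℕ) : ZMod (24 * t + 14)) by
    push_cast; ring, hpCyc_nat t (2 * j + 1) (by omega), if_neg (by omega), hz, hx']
  by_cases hl : 2 * j + 2 < 24 * t + 14
  · rw [hpCyc_nat t (2 * j + 2) hl, if_pos (by omega)]
  · have hj' : 2 * j + 2 = 24 * t + 14 := by omega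
    have e0 : ((2 * j + 2 : ℕ) : ZMod (24 * t + 14)) = ((0 : ℕ) : ZMod (24 * t + 14)) := by
      rw [hj', ZMod.natCast_self, Nat.cast_zero]
    have e1 : ((2 * j + 2 : ℕ) : ZMod (12 * t + 7)) = ((0 : ℕ) : ZMod (12 * t + 7)) := by
      rw [hj', show 24 * t + 14 = (12 * t + 7) + (12 * t + 7) by ring, Nat.cast_add,
        ZMod.natCast_self, Nat.cast_zero, add_zero]
    rw [e0, e1, hpCyc_nat t 0 (by omega), if_pos (by omega)]

theorem covered_le (t : ℕ) (o p : Fin 4) (hop : o ≤ p) (x z : ZMod (12 * t + 7))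
    (hne : (some (o, x) : Vert t) ≠ some (p, z)) : Covered t (some (o, x)) (some (p, z)) := by
  obtain ⟨D, h0, h1, hD⟩ := exists_rep t (z - x)
  have hD0 : o = p → 1 ≤ D := by
    intro h
    rcases h0.lt_or_eq with h' | h'
    · omega
    · rw [← h', Int.cast_zero] at hD
      exact absurd (by rw [h, sub_eq_zero.1 hD.symm]) hne
  by_cases h02 : o = 0 ∧ p = 2
  · obtain ⟨rfl, rfl⟩ := h02
    rcases cov02 t D h0 h1 with h | h | h
    · exact covered_of_good h hD
    · exact covered_hp2 t (h ▸ hD)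
    · exact covered_hp1 t (h ▸ hD)
  · refine covered_of_good ?_ hD
    fin_cases o <;> fin_cases p <;> first
      | exact absurd hop (by decide)
      | exact absurd (And.intro rfl rfl) h02
      | exact cov00 t D (hD0 rfl) h1
      | exact cov11 t D (hD0 rfl) h1
      | exact cov22 t D (hD0 rfl) h1
      | exact cov33 t D (hD0 rfl) h1
      | exact cov01 t D h0 h1
      | exact cov03 t D h0 h1
      | exact cov12 t D h0 h1
      | exact cov13 t D h0 h1
      | exact cov23 t D h0 h1

theorem covered_all (t : ℕ) (x y : Vert t) (hne : x ≠ y) : Covered t x y := by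
  rcases x with _ | ⟨o, x⟩ <;> rcases y with _ | ⟨p, z⟩
  · exact absurd rfl hne
  · exact covered_of_infGood (covInf t p) z
  · exact (covered_of_infGood (covInf t o) x).symm
  · rcases le_total o p with h | h
    · exact covered_le t o p h x z hne
    · exact (covered_le t p o h z x hne.symm).symm

/-- The vertex missed by the base class `c`. -/
def missed (t : ℕ) (c : Fin 2) : Fin 4 × ℤ := if c = 0 then (0, 6 * t + 3) else (2, 0)

theorem vcov (t : ℕ) (c : Fin 2) (o : Fin 4) (D : ℤ) (h0 : 0 ≤ D) (h1 : D < 12 * t + 7)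
    (hm : (o, D) ≠ missed t c) : VGood t c o D := by
  have hm0 : ∀ D', missed t c = (o, D') → D ≠ D' := by
    rintro D' h rfl
    exact hm h.symm
  fin_cases c <;> fin_cases o <;> first
    | exact vcov00 t D h0 h1 (hm0 _ rfl)
    | exact vcov01 t D h0 h1
    | exact vcov02 t D h0 h1
    | exact vcov03 t D h0 h1
    | exact vcov10 t D h0 h1
    | exact vcov11 t D h0 h1
    | exact vcov12 t D h0 h1 (hm0 _ rfl)
    | exact vcov13 t D h0 h1

theorem apCyc_surj (t : ℕ) (i : Fin 2 × ZMod (12 * t + 7)) :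
    ∃ m, ∀ x, x ≠ m → ∃ j a, apCyc t i j a = x := by
  obtain ⟨c, s⟩ := i
  have key : ∀ (q : Fin 2) (r : ℕ), r < 24 * t + 14 →
      apCyc t (c, s) q (r : ZMod (24 * t + 14)) = shift t s (base t c q r) := by
    intro q r hr
    unfold apCyc
    rw [ZMod.val_natCast, Nat.mod_eq_of_lt hr]
  refine ⟨shift t s (some (missed t c)), fun x hx => ?_⟩
  rcases x with _ | ⟨o, x⟩
  · have : ∃ q : Fin 2, ∃ i : ℕ, i < 24 * t + 14 ∧ base t c q i = none := by
      fin_cases c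
      · exact infv0 t
      · exact infv1 t
    obtain ⟨q, r, hr, hb⟩ := this
    exact ⟨q, (r : ZMod (24 * t + 14)), by rw [key q r hr, hb]; rfl⟩
  · obtain ⟨D, h0, h1, hD⟩ := exists_rep t (x - s)
    have hs : ∀ m : ℤ, shift t s (some (o, D + m * (12 * t + 7))) = some (o, x) := by
      intro m
      simp [shift, hD, cast_n]
    have hm : (o, D) ≠ missed t c := by
      intro h
      apply hx
      rw [← h, ← hs 0]
      simp
    obtain ⟨q, r, hr, m, hb⟩ := vcov t c o D h0 h1 hm
    exact ⟨q, (r : ZMod (24 * t + 14)), by rw [key q r hr, hb, hs]⟩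

theorem hpCyc_inj (t : ℕ) : Function.Injective (hpCyc t) := by
  have : NeZero (24 * t + 14) := ⟨by omega⟩
  -- two values of the same parity, congruent modulo `12 t + 7`, are equal
  have key : ∀ a b : ZMod (24 * t + 14), a.val % 2 = b.val % 2 →
      (a.val : ZMod (12 * t + 7)) = (b.val : ZMod (12 * t + 7)) → a = b := by
    intro a b h2 hn
    rw [ZMod.natCast_eq_natCast_iff] at hn
    have h2' : a.val ≡ b.val [MOD 2] := h2
    have hco : Nat.Coprime 2 (12 * t + 7) := by
      rw [Nat.coprime_two_left]; exact ⟨6 * t + 3, by ring⟩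
    have h := (Nat.modEq_and_modEq_iff_modEq_mul hco).1 ⟨h2', hn⟩
    rw [show 2 * (12 * t + 7) = 24 * t + 14 by ring] at h
    exact ZMod.val_injective _ (h.eq_of_lt_of_lt (ZMod.val_lt a) (ZMod.val_lt b))
  intro a b hab
  unfold hpCyc at hab
  split_ifs at hab with ha hb hb
  · exact key a b (by omega) (Prod.mk.inj (Option.some.inj hab)).2
  · exact absurd (Prod.mk.inj (Option.some.inj hab)).1 (by decide)
  · exact absurd (Prod.mk.inj (Option.some.inj hab)).1 (by decide)
  · exact key a b (by omega) (add_right_cancel (Prod.mk.inj (Option.some.inj hab)).2)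


/-- For every `k ≥ 38` with `k ≡ 14 (mod 24)`, there exists an almost resolvable
`k`-cycle system of order `2k+1`. -/
theorem arcs_mod24_case_14 (k : ℕ) (hk : 38 ≤ k) (hk24 : k % 24 = 14) :
    HasARCS k (2 * k + 1) := by
  obtain ⟨t, rfl⟩ : ∃ t, k = 24 * t + 14 := ⟨k / 24, by omega⟩
  have : NeZero (24 * t + 14) := ⟨by omega⟩
  have : NeZero (12 * t + 7) := ⟨by omega⟩
  refine hasARCS_of (V := Vert t) (I := Fin 2 × ZMod (12 * t + 7)) ?_ ?_ (apCyc t) (hpCyc t)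
    (apCyc_surj t) (hpCyc_inj t) (covered_all t)
  · simp only [Fintype.card_option, Fintype.card_prod, Fintype.card_fin, ZMod.card]; ring
  · simp only [Fintype.card_prod, Fintype.card_fin, ZMod.card]; ring
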